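/- For every k ∈ ℤ³ \ {0} there exists a constant C > 0 such that for all real R ≥ 1 the following holds: every p ∈ ℤ³ with |p| > R ≥ |p − k| satisfies |p|² − |p − k|² ≥ 1, and ∑_{p ∈ ℤ³, |p| > R ≥ |p−k|} 1/(|p|² − |p − k|²) ≤ C·R. -/

import Mathlib

open scoped BigOperators

/-- Euclidean norm of a lattice point in `ℤ³`. -/
noncomputable def latNorm (p : Fin 3 → ℤ) : ℝ := Real.sqrt (∑ i, ((p i : ℝ)) ^ 2)

def lsq (p : Fin 3 → ℤ) : ℤ := ∑ i, p i ^ 2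
def ldot (p k : Fin 3 → ℤ) : ℤ := ∑ i, p i * k i
def lv (k p : Fin 3 → ℤ) (j : Fin 3) : ℤ := k (j+1) * p (j+2) - k (j+2) * p (j+1)
def ln (k p : Fin 3 → ℤ) (j : Fin 3) : ℤ := lsq k * p j - ldot p k * k j
def lW (k : Fin 3 → ℤ) (j : Fin 3) : ℤ := k (j+1) ^ 2 + k (j+2) ^ 2

lemma latNorm_sq (p : Fin 3 → ℤ) : latNorm p ^ 2 = (lsq p : ℝ) := by
  unfold latNorm lsq
  rw [Real.sq_sqrt (Finset.sum_nonneg fun i _ => sq_nonneg _)]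
  push_cast; rfl

lemma lsum (f : Fin 3 → ℤ) (j : Fin 3) : ∑ i, f i = f j + f (j+1) + f (j+2) := by
  rw [Fin.sum_univ_three]
  fin_cases j
  · rfl
  · change _ = f 1 + f 2 + f 0; ring
  · change _ = f 2 + f 0 + f 1; ring

lemma lident (k p : Fin 3 → ℤ) (j : Fin 3) :
    lW k j * (lsq k * lsq p - ldot p k ^ 2) = lsq k * lv k p j ^ 2 + ln k p j ^ 2 := by
  unfold ln lW lv lsq ldot
  rw [lsum (fun i => k i ^ 2) j, lsum (fun i => p i ^ 2) j, lsum (fun i => p i * k i) j]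
  ring

lemma lnsum (k p : Fin 3 → ℤ) :
    ∑ j, ln k p j ^ 2 = lsq k * (lsq k * lsq p - ldot p k ^ 2) := by
  unfold ln lsq ldot
  simp only [Fin.sum_univ_three]
  ring

lemma lsq_sub (p k : Fin 3 → ℤ) : lsq (p - k) = lsq p - 2 * ldot p k + lsq k := by
  unfold lsq ldot
  simp only [Fin.sum_univ_three, Pi.sub_apply]
  ring

lemma lsq_nonneg (p : Fin 3 → ℤ) : 0 ≤ lsq p := Finset.sum_nonneg fun i _ => sq_nonneg _

lemma lsq_eq_zero {p : Fin 3 → ℤ} (h : lsq p = 0) : p = 0 := by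
  unfold lsq at h
  rw [Finset.sum_eq_zero_iff_of_nonneg (fun i _ => sq_nonneg _)] at h
  ext i
  simpa using h i (Finset.mem_univ i)

lemma lW_le (k : Fin 3 → ℤ) (j : Fin 3) : lW k j ≤ lsq k := by
  unfold lW lsq
  rw [lsum (fun i => k i ^ 2) j]
  nlinarith [sq_nonneg (k j)]

lemma lW_nonneg (k : Fin 3 → ℤ) (j : Fin 3) : 0 ≤ lW k j := by
  unfold lW; positivity

/-- lune membership in integer form -/
def Lune (k : Fin 3 → ℤ) (R : ℝ) (p : Fin 3 → ℤ) : Prop :=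
  R ^ 2 < (lsq p : ℝ) ∧ ((lsq p - 2 * ldot p k + lsq k : ℤ) : ℝ) ≤ R ^ 2

lemma lune_iff (k : Fin 3 → ℤ) (R : ℝ) (hR : 1 ≤ R) (p : Fin 3 → ℤ) :
    (R < latNorm p ∧ latNorm (p - k) ≤ R) ↔ Lune k R p := by
  unfold Lune
  rw [← lsq_sub, ← latNorm_sq, ← latNorm_sq]
  have h1 : 0 ≤ latNorm p := Real.sqrt_nonneg _
  have h2 : 0 ≤ latNorm (p - k) := Real.sqrt_nonneg _
  rw [sq_lt_sq₀ (by linarith) h1, sq_le_sq₀ h2 (by linarith)]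

lemma lune_pos {k : Fin 3 → ℤ} {R : ℝ} {p : Fin 3 → ℤ} (h : Lune k R p) :
    1 ≤ 2 * ldot p k - lsq k := by
  have : lsq p - 2 * ldot p k + lsq k < lsq p := by exact_mod_cast h.2.trans_lt h.1
  omega

lemma lsq_add (p k : Fin 3 → ℤ) (t : ℤ) :
    lsq (p + t • k) = lsq p + 2 * t * ldot p k + t ^ 2 * lsq k := by
  unfold lsq ldot
  simp only [Fin.sum_univ_three, Pi.add_apply, Pi.smul_apply, smul_eq_mul]
  ring

lemma ldot_add (p k : Fin 3 → ℤ) (t : ℤ) :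
    ldot (p + t • k) k = ldot p k + t * lsq k := by
  unfold lsq ldot
  simp only [Fin.sum_univ_three, Pi.add_apply, Pi.smul_apply, smul_eq_mul]
  ring

lemma lune_line {k : Fin 3 → ℤ} {R : ℝ} {p : Fin 3 → ℤ} (h : Lune k R p) (t : ℤ)
    (h' : Lune k R (p + t • k)) : t ≤ 0 := by
  by_contra ht
  have hp := lune_pos h
  have h3 := h'.2
  rw [lsq_add, ldot_add] at h3
  have h4 : lsq p + 2 * t * ldot p k + t ^ 2 * lsq k - 2 * (ldot p k + t * lsq k) + lsq k < lsq p := by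
    exact_mod_cast h3.trans_lt h.1
  have hK := lsq_nonneg k
  nlinarith [mul_nonneg (by omega : 0 ≤ t - 1) (by omega : 0 ≤ ldot p k),
    mul_nonneg (sq_nonneg (t-1)) hK]

lemma lune_inj {k : Fin 3 → ℤ} (hk : 0 < lsq k) {R : ℝ} {p p' : Fin 3 → ℤ} (h : Lune k R p)
    (h' : Lune k R p') (j : Fin 3) (hW : lW k j ≠ 0) (hv : lv k p j = lv k p' j)
    (hn : ln k p j = ln k p' j) (hu : ldot p k % lsq k = ldot p' k % lsq k) : p = p' := by
  obtain ⟨t, ht⟩ := Int.ModEq.dvd (show ldot p' k ≡ ldot p k [ZMOD lsq k] from hu.symm)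
  have hd : ldot (p - p') k = lsq k * t := by
    rw [← ht]; unfold ldot; simp only [Fin.sum_univ_three, Pi.sub_apply]; ring
  have e1 : lv k (p - p') j = 0 := by
    unfold lv at *; simp only [Pi.sub_apply]; linarith
  have e2 : ln k (p - p') j = 0 := by
    have : ln k (p - p') j = ln k p j - ln k p' j := by
      unfold ln ldot; simp only [Fin.sum_univ_three, Pi.sub_apply]; ring
    rw [this, hn, sub_self]
  have e3 := lident k (p - p') j
  rw [e1, e2, hd] at e3
  have e4 : lsq k * lsq (p - p') - (lsq k * t) ^ 2 = 0 := by
    rcases mul_eq_zero.1 (e3.trans (by ring)) with h | h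
    · exact absurd h hW
    · exact h
  have e5 : lsq (p - p') = lsq k * t ^ 2 := by
    have : lsq k * (lsq (p - p') - lsq k * t ^ 2) = 0 := by linarith
    rcases mul_eq_zero.1 this with h | h <;> linarith
  have e6 : lsq ((p - p') + (-t) • k) = 0 := by
    rw [lsq_add, hd, e5]; ring
  have e7 := lsq_eq_zero e6
  have e8 : p = p' + t • k := by
    have : p - p' - t • k = 0 := by rw [← e7, neg_smul, sub_eq_add_neg]
    rw [sub_sub, sub_eq_zero] at this; exact this
  have e9 : p' = p + (-t) • k := by rw [e8]; simp
  have t1 := lune_line h' t (e8 ▸ h)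
  have t2 := lune_line h (-t) (e9 ▸ h')
  have : t = 0 := by omega
  rw [e8, this]; simp

lemma card_le_of_close (T : Finset ℤ) (D : ℝ) (hD : 0 ≤ D)
    (h : ∀ x ∈ T, ∀ y ∈ T, (x : ℝ) - y ≤ D) : (T.card : ℝ) ≤ D + 1 := by
  rcases T.eq_empty_or_nonempty with rfl | hT
  · simp; linarith
  have h1 : T ⊆ Finset.Icc (T.min' hT) (T.max' hT) := fun x hx =>
    Finset.mem_Icc.2 ⟨T.min'_le x hx, T.le_max' x hx⟩
  have h2 := Finset.card_le_card h1
  rw [Int.card_Icc] at h2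
  have h3 := h _ (T.max'_mem hT) _ (T.min'_mem hT)
  have h4 := T.min'_le _ (T.max'_mem hT)
  have h5 : ((T.card : ℤ)) ≤ T.max' hT + 1 - T.min' hT := by omega
  have h6 : (T.card : ℝ) ≤ T.max' hT + 1 - T.min' hT := by exact_mod_cast h5
  linarith

lemma ldot_cs (p k : Fin 3 → ℤ) : ldot p k ^ 2 ≤ lsq p * lsq k := by
  unfold ldot lsq
  exact Finset.sum_mul_sq_le_sq_mul_sq _ _ _

lemma lune_u {k : Fin 3 → ℤ} (hk : 0 < lsq k) {R : ℝ} (hR : 1 ≤ R) {p : Fin 3 → ℤ}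
    (h : Lune k R p) : (ldot p k : ℝ) ≤ 2 * lsq k * R := by
  have h1 := ldot_cs (p - k) k
  have h2 : ldot (p - k) k = ldot p k - lsq k := by
    unfold ldot lsq; simp only [Fin.sum_univ_three, Pi.sub_apply]; ring
  rw [h2, lsq_sub] at h1
  have h3 : ((ldot p k : ℝ) - lsq k) ^ 2 ≤ ((lsq p - 2 * ldot p k + lsq k : ℤ) : ℝ) * lsq k := by
    exact_mod_cast h1
  have hK : (1 : ℝ) ≤ lsq k := by exact_mod_cast hk
  have h4 : ((ldot p k : ℝ) - lsq k) ^ 2 ≤ (lsq k * R) ^ 2 := by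
    calc _ ≤ _ := h3
      _ ≤ R ^ 2 * lsq k := by gcongr; exact h.2
      _ ≤ _ := by nlinarith [mul_nonneg (sq_nonneg R) (sub_nonneg.2 hK), sq_nonneg R]
  have h5 := abs_le_of_sq_le_sq' h4 (by positivity)
  nlinarith [h5.2]

lemma lune_sq {k : Fin 3 → ℤ} (hk : 0 < lsq k) {R : ℝ} (hR : 1 ≤ R) {p : Fin 3 → ℤ}
    (h : Lune k R p) : (lsq p : ℝ) ≤ 5 * lsq k * R ^ 2 := by
  have h1 := lune_u hk hR h
  have h2 := h.2
  push_cast at h2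
  have hK : (1 : ℝ) ≤ lsq k := by exact_mod_cast hk
  nlinarith [mul_nonneg (by linarith : (0:ℝ) ≤ lsq k * 4) (mul_nonneg (by linarith : 0 ≤ R) (by linarith : 0 ≤ R - 1)), mul_nonneg (sub_nonneg.2 hK) (sq_nonneg R)]

lemma lvn_bound (k p : Fin 3 → ℤ) (hk : 0 < lsq k) (j : Fin 3) :
    lv k p j ^ 2 ≤ lsq k * lsq p ∧ ln k p j ^ 2 ≤ lsq k ^ 2 * lsq p := by
  have h1 := lident k p j
  have h2 := lW_le k j
  have h3 := lW_nonneg k j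
  have h4 := lsq_nonneg p
  have h5 : lW k j * (lsq k * lsq p - ldot p k ^ 2) ≤ lsq k * (lsq k * lsq p) := by
    have := mul_le_mul_of_nonneg_right h2 (mul_nonneg hk.le h4)
    nlinarith [mul_nonneg h3 (sq_nonneg (ldot p k))]
  constructor
  · have : lsq k * lv k p j ^ 2 ≤ lsq k * (lsq k * lsq p) := by nlinarith [sq_nonneg (ln k p j)]
    exact le_of_mul_le_mul_left this hk
  · nlinarith [mul_nonneg hk.le (sq_nonneg (lv k p j))]

lemma count_lemma {k : Fin 3 → ℤ} (hk : 0 < lsq k) {R : ℝ} (hR : 1 ≤ R) (s : Finset (Fin 3 → ℤ))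
    (hs : ∀ p ∈ s, Lune k R p) (j : Fin 3) (hW : lW k j ≠ 0) (D : ℝ) (hD : 0 ≤ D)
    (h : ∀ p ∈ s, ∀ p' ∈ s, lv k p j = lv k p' j → (ln k p j : ℝ) - ln k p' j ≤ D) :
    (s.card : ℝ) ≤ 7 * lsq k ^ 2 * R * (D + 1) := by
  classical
  have hK : (1 : ℝ) ≤ lsq k := by exact_mod_cast hk
  have hKR : 1 ≤ lsq k * R := by nlinarith
  set B : ℤ := ⌊3 * (lsq k : ℝ) * R⌋ with hB
  have hB0 : 0 ≤ B := Int.floor_nonneg.2 (by positivity)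
  have hB1 : (B : ℝ) ≤ 3 * (lsq k : ℝ) * R := Int.floor_le _
  let f : (Fin 3 → ℤ) → ℤ × ℤ := fun p => (lv k p j, ldot p k % lsq k)
  have h1 := Finset.card_le_mul_card_image_of_maps_to (f := f) (s := s)
    (t := Finset.Icc (-B) B ×ˢ Finset.Ico 0 (lsq k)) (by
      intro p hp
      simp only [f, Finset.mem_coe, Finset.mem_product, Finset.mem_Icc, Finset.mem_Ico]
      refine ⟨?_, Int.emod_nonneg _ hk.ne', Int.emod_lt_of_pos _ hk⟩
      have a1 := (lvn_bound k p hk j).1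
      have a2 : (lv k p j : ℝ) ^ 2 ≤ lsq k * lsq p := by exact_mod_cast a1
      have a3 := lune_sq hk hR (hs p hp)
      have a4 : (lv k p j : ℝ) ^ 2 ≤ (3 * lsq k * R) ^ 2 := by
        nlinarith [mul_le_mul_of_nonneg_left a3 (by linarith : (0:ℝ) ≤ lsq k), sq_nonneg (lsq k * R : ℝ)]
      have a5 := abs_le_of_sq_le_sq' a4 (by positivity)
      constructor
      · rw [neg_le]
        apply Int.le_floor.2
        push_cast; linarith [a5.1]
      · exact Int.le_floor.2 a5.2) ⌊D + 1⌋₊ (by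
      intro b _
      apply Nat.le_floor
      have inj : Set.InjOn (fun p => ln k p j) (s.filter fun p => f p = b : Finset _) := by
        intro p hp p' hp' e
        simp only [Finset.coe_filter, Set.mem_setOf_eq] at hp hp'
        have e1 := hp.2.trans hp'.2.symm
        simp only [f, Prod.mk.injEq] at e1
        exact lune_inj hk (hs p hp.1) (hs p' hp'.1) j hW e1.1 e e1.2
      rw [← Finset.card_image_of_injOn inj]
      apply card_le_of_close _ _ hD
      intro x hx y hy
      simp only [Finset.mem_image, Finset.mem_filter] at hx hy
      obtain ⟨p, ⟨hp, hpb⟩, rfl⟩ := hx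
      obtain ⟨p', ⟨hp', hpb'⟩, rfl⟩ := hy
      have e1 := hpb.trans hpb'.symm
      simp only [f, Prod.mk.injEq] at e1
      exact h p hp p' hp' e1.1)
  rw [Finset.card_product, Int.card_Icc, Int.card_Ico] at h1
  have h2 : (((B + 1 - -B).toNat : ℕ) : ℝ) = 2 * B + 1 := by
    have : (((B + 1 - -B).toNat : ℕ) : ℤ) = 2 * B + 1 := by omega
    exact_mod_cast this
  have h3 : (((lsq k - 0).toNat : ℕ) : ℝ) = lsq k := by
    have : (((lsq k - 0).toNat : ℕ) : ℤ) = lsq k := by omega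
    exact_mod_cast this
  have h4 : (s.card : ℝ) ≤ (⌊D + 1⌋₊ : ℝ) * ((2 * B + 1) * lsq k) := by
    rw [← h2, ← h3]; exact_mod_cast h1
  have hB0' : (0 : ℝ) ≤ B := by exact_mod_cast hB0
  calc (s.card : ℝ) ≤ _ := h4
    _ ≤ (D + 1) * ((7 * lsq k * R) * lsq k) := by
      gcongr
      · exact Nat.floor_le (by linarith)
      · nlinarith
    _ = _ := by ring

lemma exists_lW {k : Fin 3 → ℤ} (hk : 0 < lsq k) : ∃ j, lW k j ≠ 0 := by
  by_contra h
  push Not at h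
  have h0 := h 0
  have h1 := h 1
  have h2 := h 2
  unfold lW at *
  unfold lsq at hk
  rw [Fin.sum_univ_three] at hk
  simp at h0 h1 h2
  change k 2 ^ 2 + k 0 ^ 2 = 0 at h1
  change k 0 ^ 2 + k 1 ^ 2 = 0 at h2
  nlinarith [sq_nonneg (k 0), sq_nonneg (k 1), sq_nonneg (k 2)]

lemma count_triv {k : Fin 3 → ℤ} (hk : 0 < lsq k) {R : ℝ} (hR : 1 ≤ R) (s : Finset (Fin 3 → ℤ))
    (hs : ∀ p ∈ s, Lune k R p) : (s.card : ℝ) ≤ 77 * lsq k ^ 4 * R ^ 2 := by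
  obtain ⟨j, hj⟩ := exists_lW hk
  have hK : (1 : ℝ) ≤ lsq k := by exact_mod_cast hk
  have hb : ∀ p ∈ s, |(ln k p j : ℝ)| ≤ 5 * lsq k ^ 2 * R := by
    intro p hp
    apply abs_le_of_sq_le_sq _ (by positivity)
    have a1 := (lvn_bound k p hk j).2
    have a2 : (ln k p j : ℝ) ^ 2 ≤ lsq k ^ 2 * lsq p := by exact_mod_cast a1
    have a3 := lune_sq hk hR (hs p hp)
    calc _ ≤ _ := a2
      _ ≤ (lsq k : ℝ) ^ 2 * (5 * lsq k * R ^ 2) := by gcongr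
      _ = 5 * R ^ 2 * (lsq k : ℝ) ^ 3 := by ring
      _ ≤ 25 * R ^ 2 * (lsq k : ℝ) ^ 4 := by gcongr <;> norm_num
      _ = _ := by ring
  have := count_lemma hk hR s hs j hj (10 * lsq k ^ 2 * R) (by positivity) (by
    intro p hp p' hp' _
    have a := abs_le.1 (hb p hp)
    have b := abs_le.1 (hb p' hp')
    linarith)
  refine this.trans ?_
  have h1 : 1 ≤ (lsq k : ℝ) ^ 2 * R := one_le_mul_of_one_le_of_one_le (one_le_pow₀ hK) hR
  calc _ ≤ 7 * (lsq k : ℝ) ^ 2 * R * (11 * lsq k ^ 2 * R) := by gcongr; linarith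
    _ = _ := by ring

lemma count_small {k : Fin 3 → ℤ} (hk : 0 < lsq k) {R : ℝ} (hR : 1 ≤ R) (s : Finset (Fin 3 → ℤ))
    (hs : ∀ p ∈ s, Lune k R p) (M : ℝ) (hM : 1 ≤ M)
    (hm : ∀ p ∈ s, ((2 * ldot p k - lsq k : ℤ) : ℝ) ≤ M)
    (hMR : 2 * lsq k * M ^ 2 ≤ R ^ 2) :
    (s.card : ℝ) ≤ 42 * lsq k ^ 2 * (3 * lsq k ^ 2 * M ^ 2 + R) := by
  classical
  have hK : (1 : ℝ) ≤ lsq k := by exact_mod_cast hk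
  set K : ℝ := ((lsq k : ℤ) : ℝ) with hKdef
  have hR0 : 0 < R := by linarith
  -- bounds on |v|^2
  have hvv : ∀ p ∈ s, K * R ^ 2 - K ^ 2 * M ^ 2 ≤ K * lsq p - (ldot p k : ℝ) ^ 2 ∧
      K * lsq p - (ldot p k : ℝ) ^ 2 ≤ K * R ^ 2 + K * M := by
    intro p hp
    have a1 := hs p hp
    have a2 := hm p hp
    have a3 := lune_pos a1
    have a4 : (1 : ℝ) ≤ 2 * ldot p k - K := by rw [hKdef]; exact_mod_cast a3
    have a5 := a1.1
    have a6 := a1.2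
    push_cast at a2 a6
    rw [← hKdef] at a2 a6
    have a7 : (ldot p k : ℝ) ≤ K * M := by nlinarith [mul_nonneg (sub_nonneg.2 hK) (sub_nonneg.2 hM)]
    have a8 : (0 : ℝ) ≤ ldot p k := by linarith
    constructor
    · have : (ldot p k : ℝ) ^ 2 ≤ (K * M) ^ 2 := by gcongr
      nlinarith
    · nlinarith [sq_nonneg (ldot p k : ℝ)]
  have key : ∀ j : Fin 3, ∀ e : Bool,
      (((s.filter fun p => K * R / 3 ≤ (if e then (ln k p j : ℝ) else -(ln k p j : ℝ))).card : ℕ) : ℝ)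
        ≤ 7 * K ^ 2 * (3 * K ^ 2 * M ^ 2 + R) := by
    intro j e
    set s' := s.filter fun p => K * R / 3 ≤ (if e then (ln k p j : ℝ) else -(ln k p j : ℝ)) with hs'
    rcases s'.eq_empty_or_nonempty with h0 | ⟨p0, hp0⟩
    · rw [h0]; simp; positivity
    have hW : lW k j ≠ 0 := by
      intro hW
      have a1 := lident k p0 j
      rw [hW] at a1
      have a2 : ln k p0 j ^ 2 = 0 := by
        nlinarith [sq_nonneg (ln k p0 j), mul_nonneg hk.le (sq_nonneg (lv k p0 j))]
      have a3 : ln k p0 j = 0 := by simpa using a2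
      have a4 := (Finset.mem_filter.1 hp0).2
      rw [a3] at a4
      have : 0 < K * R := by positivity
      simp at a4; linarith
    have := count_lemma hk hR s' (fun p hp => hs p (Finset.mem_filter.1 hp).1) j hW
      (3 * K ^ 2 * M ^ 2 / R) (by positivity) (by
      intro p hp p' hp' hv
      obtain ⟨b1, c1⟩ := Finset.mem_filter.1 hp
      obtain ⟨b2, c2⟩ := Finset.mem_filter.1 hp'
      have i1 := lident k p j
      have i2 := lident k p' j
      rw [hv] at i1
      have i3 : (lW k j : ℝ) * ((K * lsq p - (ldot p k : ℝ) ^ 2) - (K * lsq p' - (ldot p' k : ℝ) ^ 2))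
          = ((ln k p j : ℝ) - ln k p' j) * (ln k p j + ln k p' j) := by
        have : lW k j * ((lsq k * lsq p - (ldot p k) ^ 2) - (lsq k * lsq p' - (ldot p' k) ^ 2))
          = (ln k p j - ln k p' j) * (ln k p j + ln k p' j) := by linarith
        rw [hKdef]
        exact_mod_cast this
      have w1 : (lW k j : ℝ) ≤ K := by rw [hKdef]; exact_mod_cast lW_le k j
      have w0 : (0 : ℝ) ≤ lW k j := by exact_mod_cast lW_nonneg k j
      have v1 := hvv p b1
      have v2 := hvv p' b2
      have S : |(lW k j : ℝ) * ((K * lsq p - (ldot p k : ℝ) ^ 2) - (K * lsq p' - (ldot p' k : ℝ) ^ 2))|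
          ≤ K * (2 * K ^ 2 * M ^ 2) := by
        rw [abs_mul, abs_of_nonneg w0]
        apply mul_le_mul w1 _ (abs_nonneg _) (by linarith)
        have : K * M ≤ K ^ 2 * M ^ 2 := by
          have : 1 ≤ K * M := one_le_mul_of_one_le_of_one_le hK hM
          nlinarith
        rw [abs_le]; constructor <;> linarith [v1.1, v1.2, v2.1, v2.2]
      rw [i3, abs_mul] at S
      have T : 2 * (K * R / 3) ≤ |(ln k p j : ℝ) + ln k p' j| := by
        cases e
        · simp at c1 c2
          rw [← abs_neg]
          exact le_trans (by linarith) (le_abs_self _)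
        · simp at c1 c2
          exact le_trans (by linarith) (le_abs_self _)
      refine (le_abs_self _).trans ?_
      rw [le_div_iff₀ hR0]
      have U := (mul_le_mul_of_nonneg_left T (abs_nonneg ((ln k p j : ℝ) - ln k p' j))).trans S
      have hKp : 0 < K * (2/3) := by positivity
      refine le_of_mul_le_mul_left ?_ hKp
      calc _ = |(ln k p j : ℝ) - ln k p' j| * (2 * (K * R / 3)) := by ring
        _ ≤ _ := U
        _ = _ := by ring)
    refine this.trans (le_of_eq ?_)
    rw [← hKdef]; field_simp
  have cover : s ⊆ (Finset.univ : Finset (Fin 3 × Bool)).biUnion fun je =>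
      s.filter fun p => K * R / 3 ≤ (if je.2 then (ln k p je.1 : ℝ) else -(ln k p je.1 : ℝ)) := by
    intro p hp
    simp only [Finset.mem_biUnion, Finset.mem_univ, true_and, Finset.mem_filter]
    by_contra hcon
    push Not at hcon
    have hlt : ∀ j, (ln k p j : ℝ) ^ 2 < (K * R / 3) ^ 2 := by
      intro j
      have t := hcon (j, true) hp
      have f := hcon (j, false) hp
      simp at t f
      apply sq_lt_sq'
      · linarith
      · exact t
    have sum := lnsum k p
    rw [Fin.sum_univ_three] at sum
    have sum' : (ln k p 0 : ℝ) ^ 2 + (ln k p 1 : ℝ) ^ 2 + (ln k p 2 : ℝ) ^ 2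
      = K * (K * lsq p - (ldot p k : ℝ) ^ 2) := by rw [hKdef]; exact_mod_cast sum
    have v1 := (hvv p hp).1
    have v2 : K * R ^ 2 / 2 ≤ K * lsq p - (ldot p k : ℝ) ^ 2 := by
      nlinarith [mul_le_mul_of_nonneg_left hMR (by linarith : 0 ≤ K)]
    have v3 := mul_le_mul_of_nonneg_left v2 (by linarith : 0 ≤ K)
    have := hlt 0
    have := hlt 1
    have := hlt 2
    nlinarith [sq_nonneg (K * R)]
  have c1 := (Finset.card_le_card cover).trans Finset.card_biUnion_le
  have c2 : (s.card : ℝ) ≤ ∑ je : Fin 3 × Bool, (((s.filter fun p => K * R / 3 ≤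
      (if je.2 then (ln k p je.1 : ℝ) else -(ln k p je.1 : ℝ))).card : ℕ) : ℝ) := by exact_mod_cast c1
  refine c2.trans ((Finset.sum_le_sum fun je _ => key je.1 je.2).trans (le_of_eq ?_))
  simp; ring

lemma count_all {k : Fin 3 → ℤ} (hk : 0 < lsq k) {R : ℝ} (hR : 1 ≤ R) (s : Finset (Fin 3 → ℤ))
    (hs : ∀ p ∈ s, Lune k R p) (M : ℝ) (hM : 1 ≤ M)
    (hm : ∀ p ∈ s, ((2 * ldot p k - lsq k : ℤ) : ℝ) ≤ M) :
    (s.card : ℝ) ≤ 154 * lsq k ^ 5 * (M ^ 2 + R) := by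
  have hK : (1 : ℝ) ≤ lsq k := by exact_mod_cast hk
  have hR0 : 0 < R := by linarith
  by_cases hMR : 2 * lsq k * M ^ 2 ≤ R ^ 2
  · refine (count_small hk hR s hs M hM hm hMR).trans ?_
    have h1 : (lsq k : ℝ) ^ 4 ≤ lsq k ^ 5 := pow_le_pow_right₀ hK (by norm_num)
    have h2 : (lsq k : ℝ) ^ 2 ≤ lsq k ^ 5 := pow_le_pow_right₀ hK (by norm_num)
    have h3 := mul_le_mul_of_nonneg_right h1 (sq_nonneg M)
    have h4 := mul_le_mul_of_nonneg_right h2 hR0.le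
    have h5 : 0 ≤ (lsq k : ℝ) ^ 5 * M ^ 2 := by positivity
    have h6 : 0 ≤ (lsq k : ℝ) ^ 5 * R := by positivity
    nlinarith
  · push Not at hMR
    refine (count_triv hk hR s hs).trans ?_
    have h6 : 0 ≤ (lsq k : ℝ) ^ 5 * R := by positivity
    calc _ ≤ 77 * (lsq k : ℝ) ^ 4 * (2 * lsq k * M ^ 2) := by gcongr
      _ ≤ _ := by nlinarith

lemma abel {α : Type*} (F : Finset α) (f : α → ℕ) (hf : ∀ p ∈ F, 1 ≤ f p) (C R : ℝ)
    (hC : 0 ≤ C) (hR : 0 ≤ R)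
    (hN : ∀ n : ℕ, 1 ≤ n → ((F.filter fun p => f p ≤ n).card : ℝ) ≤ C * ((n : ℝ) ^ 2 + R)) (T : ℕ) :
    ∑ p ∈ F.filter (fun p => f p ≤ T), 1 / (f p : ℝ) ≤
      ((F.filter fun p => f p ≤ T).card : ℝ) / (T + 1) + C * (T + R * (1 - 1 / (T + 1))) := by
  classical
  induction T with
  | zero =>
    have : F.filter (fun p => f p ≤ 0) = ∅ := by
      apply Finset.filter_eq_empty_iff.2
      intro p hp; have := hf p hp; omega
    rw [this]; simp
  | succ T ih =>
    have hU : F.filter (fun p => f p ≤ T + 1) =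
        F.filter (fun p => f p ≤ T) ∪ F.filter (fun p => f p = T + 1) := by
      ext p; simp only [Finset.mem_filter, Finset.mem_union]
      constructor
      · rintro ⟨a, b⟩
        rcases Nat.lt_or_ge T (f p) with h | h
        · right; exact ⟨a, by omega⟩
        · left; exact ⟨a, h⟩
      · rintro (⟨a, b⟩ | ⟨a, b⟩) <;> exact ⟨a, by omega⟩
    have hdis : Disjoint (F.filter (fun p => f p ≤ T)) (F.filter (fun p => f p = T + 1)) := by
      rw [Finset.disjoint_filter]; intro p _ h; omega
    have hcard : ((F.filter (fun p => f p ≤ T + 1)).card : ℝ) =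
        (F.filter (fun p => f p ≤ T)).card + (F.filter (fun p => f p = T + 1)).card := by
      rw [hU, Finset.card_union_of_disjoint hdis]; push_cast; rfl
    have hN' := hN (T + 1) (by omega)
    have hsum : ∑ p ∈ F.filter (fun p => f p = T + 1), 1 / (f p : ℝ) =
        (F.filter (fun p => f p = T + 1)).card / ((T : ℝ) + 1) := by
      rw [Finset.sum_congr rfl (g := fun _ => 1 / ((T : ℝ) + 1)) (by
        intro p hp; rw [(Finset.mem_filter.1 hp).2]; push_cast; rfl)]
      simp [div_eq_mul_inv]
    have hs : ∑ p ∈ F.filter (fun p => f p ≤ T + 1), 1 / (f p : ℝ) =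
        ∑ p ∈ F.filter (fun p => f p ≤ T), 1 / (f p : ℝ) +
        (F.filter (fun p => f p = T + 1)).card / ((T : ℝ) + 1) := by
      rw [hU, Finset.sum_union hdis, hsum]
    rw [hs]
    push_cast at hN' ⊢
    set N1 : ℝ := ((F.filter (fun p => f p ≤ T + 1)).card : ℝ)
    set N0 : ℝ := ((F.filter (fun p => f p ≤ T)).card : ℝ)
    have e : (((F.filter (fun p => f p = T + 1)).card : ℕ) : ℝ) = N1 - N0 := by linarith
    rw [e]
    set t : ℝ := (T : ℝ) with ht
    have ht0 : 0 ≤ t := by positivity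
    have step : N1 / (t + 1) - N1 / (t + 1 + 1) ≤ C * (1 + R * (1 / (t + 1) - 1 / (t + 1 + 1))) := by
      have e1 : N1 / (t + 1) - N1 / (t + 1 + 1) = N1 / ((t + 1) * (t + 1 + 1)) := by
        field_simp; ring
      have e2 : C * (1 + R * (1 / (t + 1) - 1 / (t + 1 + 1))) =
          C * ((t + 1) * (t + 1 + 1) + R) / ((t + 1) * (t + 1 + 1)) := by
        field_simp; ring
      rw [e1, e2]
      gcongr
      refine hN'.trans ?_
      gcongr
      nlinarith
    have e3 : (N1 - N0) / (t + 1) = N1 / (t + 1) - N0 / (t + 1) := sub_div _ _ _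
    rw [e3]
    nlinarith

theorem lune_finite (k : Fin 3 → ℤ) (hk : 0 < lsq k) (R : ℝ) (hR : 1 ≤ R) :
    {p : Fin 3 → ℤ | Lune k R p}.Finite := by
  obtain ⟨B, hB⟩ := exists_nat_ge (5 * lsq k * R ^ 2)
  apply (Set.finite_Icc (fun _ : Fin 3 => -(B : ℤ)) (fun _ => (B : ℤ))).subset
  intro p hp
  have h1 := (lune_sq hk hR hp).trans hB
  have h2 : lsq p ≤ B := by exact_mod_cast h1
  have h3 : ∀ i, p i ^ 2 ≤ (B : ℤ) := fun i =>
    (Finset.single_le_sum (f := fun i => p i ^ 2) (fun i _ => sq_nonneg _) (Finset.mem_univ i)).trans h2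
  have h4 : ∀ i, |p i| ≤ (B : ℤ) := fun i => by
    rcases eq_or_ne (p i) 0 with h | h
    · rw [h]; simp
    · refine le_trans ?_ (h3 i)
      rw [← sq_abs]
      have := Int.one_le_abs h
      nlinarith
  exact ⟨fun i => (abs_le.1 (h4 i)).1, fun i => (abs_le.1 (h4 i)).2⟩

/-- For every `k ∈ ℤ³ \ {0}` there is `C > 0` such that for all `R ≥ 1`:
every `p ∈ ℤ³` with `|p| > R ≥ |p - k|` satisfies `|p|² - |p-k|² ≥ 1`, and
`∑_{|p| > R ≥ |p-k|} 1/(|p|² - |p-k|²) ≤ C·R`. -/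
theorem lattice_kinetic_sum_bound (k : Fin 3 → ℤ) (hk : k ≠ 0) :
    ∃ C : ℝ, 0 < C ∧ ∀ R : ℝ, 1 ≤ R →
      (∀ p : Fin 3 → ℤ, R < latNorm p → latNorm (p - k) ≤ R →
        (1 : ℝ) ≤ latNorm p ^ 2 - latNorm (p - k) ^ 2) ∧
      ∃ hfin : {p : Fin 3 → ℤ | R < latNorm p ∧ latNorm (p - k) ≤ R}.Finite,
        ∑ p ∈ hfin.toFinset, 1 / (latNorm p ^ 2 - latNorm (p - k) ^ 2) ≤ C * R := by
  have hk0 : 0 < lsq k := lt_of_le_of_ne (lsq_nonneg k) fun h => hk (lsq_eq_zero h.symm)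
  have hK : (1 : ℝ) ≤ lsq k := by exact_mod_cast hk0
  have hdiff : ∀ p : Fin 3 → ℤ, latNorm p ^ 2 - latNorm (p - k) ^ 2
      = ((2 * ldot p k - lsq k : ℤ) : ℝ) := by
    intro p; rw [latNorm_sq, latNorm_sq, lsq_sub]; push_cast; ring
  refine ⟨154 * (lsq k : ℝ) ^ 5 * (12 * lsq k), by positivity, fun R hR => ⟨?_, ?_, ?_⟩⟩
  · intro p h1 h2
    rw [hdiff]
    exact_mod_cast lune_pos ((lune_iff k R hR p).1 ⟨h1, h2⟩)
  · simp only [lune_iff k R hR]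
    exact lune_finite k hk0 R hR
  generalize_proofs hfin
  have hF : ∀ p ∈ hfin.toFinset, Lune k R p := by
    intro p hp
    rw [Set.Finite.mem_toFinset] at hp
    exact (lune_iff k R hR p).1 hp
  set F := hfin.toFinset
  set f : (Fin 3 → ℤ) → ℕ := fun p => (2 * ldot p k - lsq k).toNat with hfdef
  have hfz : ∀ p ∈ F, ((f p : ℕ) : ℤ) = 2 * ldot p k - lsq k := by
    intro p hp
    have := lune_pos (hF p hp)
    simp only [hfdef]; omega
  have hfr : ∀ p ∈ F, ((2 * ldot p k - lsq k : ℤ) : ℝ) = (f p : ℝ) := by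
    intro p hp; rw [← hfz p hp]; push_cast; rfl
  set C : ℝ := 154 * (lsq k : ℝ) ^ 5 with hC
  have hC0 : 0 ≤ C := by positivity
  have hN : ∀ n : ℕ, 1 ≤ n → ((F.filter fun p => f p ≤ n).card : ℝ) ≤ C * ((n : ℝ) ^ 2 + R) := by
    intro n hn
    apply count_all hk0 hR _ (fun p hp => hF p (Finset.mem_filter.1 hp).1) n (by exact_mod_cast hn)
    intro p hp
    obtain ⟨a, b⟩ := Finset.mem_filter.1 hp
    rw [hfr p a]; exact_mod_cast b
  clear_value C
  set T : ℕ := ⌈4 * (lsq k : ℝ) * R⌉₊ with hT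
  have hT1 : 4 * (lsq k : ℝ) * R ≤ T := Nat.le_ceil _
  have hT2 : (T : ℝ) < 4 * (lsq k : ℝ) * R + 1 := Nat.ceil_lt_add_one (by positivity)
  have hKR : 1 ≤ lsq k * R := one_le_mul_of_one_le_of_one_le hK hR
  have hRK : R ≤ lsq k * R := by nlinarith
  have hTpos : 1 ≤ T := by
    have : (1 : ℝ) ≤ T := by linarith
    exact_mod_cast this
  have hall : F.filter (fun p => f p ≤ T) = F := by
    apply Finset.filter_true_of_mem
    intro p hp
    have h1 := lune_u hk0 hR (hF p hp)
    have h2 := hfr p hp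
    push_cast at h2
    have : (f p : ℝ) ≤ T := by linarith
    exact_mod_cast this
  have hab := abel F f (fun p hp => by
    have := hfz p hp
    have := lune_pos (hF p hp)
    omega) C R hC0 (by linarith) hN T
  have hNT := hN T hTpos
  rw [hall] at hab hNT
  have hsum : ∑ p ∈ F, 1 / (latNorm p ^ 2 - latNorm (p - k) ^ 2) = ∑ p ∈ F, 1 / (f p : ℝ) :=
    Finset.sum_congr rfl fun p hp => by rw [hdiff, hfr p hp]
  rw [hsum]
  refine hab.trans ?_
  have t0 : (0 : ℝ) ≤ T := by positivity
  have b1 : (F.card : ℝ) / (T + 1) ≤ C * (T + R) := by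
    rw [div_le_iff₀ (by linarith)]
    refine hNT.trans ?_
    rw [mul_assoc C]
    apply mul_le_mul_of_nonneg_left _ hC0
    nlinarith
  have b2 : R * (1 - 1 / ((T : ℝ) + 1)) ≤ R := by
    have : 0 ≤ 1 / ((T : ℝ) + 1) := by positivity
    nlinarith
  calc _ ≤ C * (T + R) + C * (T + R) := by gcongr
    _ = C * (2 * T + 2 * R) := by ring
    _ ≤ C * (12 * lsq k * R) := by gcongr; linarith
    _ = _ := by ring
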